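/- arXiv:1608.03023 — 9 statements merged into one kernel-verified Lean document; each statement's English description precedes it below -/
import Mathlib

section
/- Fix real numbers p, q ∈ (0, 1). The function f : α ↦ d(α·p, α·q) is convex on the interval (0, 1). -/
/-- The Kullback-Leibler divergence between Bernoulli random variables with
means `p` and `q`. (In Lean, `Real.log 0 = 0` and `x / 0 = 0`, so the
convention `0 · log 0 = 0` holds automatically.) -/
noncomputable def klBer (p q : ℝ) : ℝ :=
  p * Real.log (p / q) + (1 - p) * Real.log ((1 - p) / (1 - q))

/-- The supporting-plane inequality at `(u, v)` for the perspective function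
`(x, y) ↦ x * log (x / y)`. -/
theorem mul_log_div_le {x y u v : ℝ} (hx : 0 < x) (hy : 0 < y) (hu : 0 < u) (hv : 0 < v) :
    x * Real.log (u / v) ≤ x * Real.log (x / y) + (u / v * y - x) := by
  have h := Real.log_le_sub_one_of_pos (div_pos (div_pos hu hv) (div_pos hx hy))
  rw [Real.log_div (div_pos hu hv).ne' (div_pos hx hy).ne'] at h
  have h2 := mul_le_mul_of_nonneg_left h hx.le
  have h3 : x * (u / v / (x / y) - 1) = u / v * y - x := by field_simp
  linarith

/-- The log-sum inequality for two terms with weights `a` and `b`. -/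
theorem add_mul_log_div_le {x₁ y₁ x₂ y₂ a b : ℝ} (hx₁ : 0 < x₁) (hy₁ : 0 < y₁)
    (hx₂ : 0 < x₂) (hy₂ : 0 < y₂) (ha : 0 ≤ a) (hb : 0 ≤ b) (hab : a + b = 1) :
    (a * x₁ + b * x₂) * Real.log ((a * x₁ + b * x₂) / (a * y₁ + b * y₂)) ≤
      a * (x₁ * Real.log (x₁ / y₁)) + b * (x₂ * Real.log (x₂ / y₂)) := by
  have hu : 0 < a * x₁ + b * x₂ := convex_Ioi (0 : ℝ) hx₁ hx₂ ha hb hab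
  have hv : 0 < a * y₁ + b * y₂ := convex_Ioi (0 : ℝ) hy₁ hy₂ ha hb hab
  have h₁ := mul_le_mul_of_nonneg_left (mul_log_div_le hx₁ hy₁ hu hv) ha
  have h₂ := mul_le_mul_of_nonneg_left (mul_log_div_le hx₂ hy₂ hu hv) hb
  have h := div_mul_cancel₀ (a * x₁ + b * x₂) hv.ne'
  linarith

theorem klBer_scaled_convexOn (p q : ℝ) (hp : p ∈ Set.Ioo (0 : ℝ) 1)
    (hq : q ∈ Set.Ioo (0 : ℝ) 1) :
    ConvexOn ℝ (Set.Ioo (0 : ℝ) 1) (fun α => klBer (α * p) (α * q)) := by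
  have pos_of_mem {r s : ℝ} (hr : r ∈ Set.Ioo (0 : ℝ) 1) (hs : s ∈ Set.Ioo (0 : ℝ) 1) :
      0 < 1 - s * r := sub_pos.2 (mul_lt_one_of_nonneg_of_lt_one_left hs.1.le hs.2 hr.2.le)
  have hconv : Convex ℝ (Set.Ioo (0 : ℝ) 1) := convex_Ioo 0 1
  refine ⟨hconv, fun s hs t ht a b ha hb hab => ?_⟩
  have hc := hconv hs ht ha hb hab
  have h := add_mul_log_div_le (pos_of_mem hp hs) (pos_of_mem hq hs) (pos_of_mem hp ht)
    (pos_of_mem hq ht) ha hb hab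
  have affine (r : ℝ) : a * (1 - s * r) + b * (1 - t * r) = 1 - (a * s + b * t) * r := by
    linear_combination hab
  rw [affine, affine] at h
  simp only [smul_eq_mul] at hc ⊢
  simp only [klBer]
  rw [mul_div_mul_left p q hc.1.ne', mul_div_mul_left p q hs.1.ne',
    mul_div_mul_left p q ht.1.ne']
  linarith
end

section
/- Fix real numbers p, q ∈ (0, 1). The function f : α ↦ d(α·p, α·q) is monotone nondecreasing on the interval (0, 1). -/
theorem klBer_mul_mul_eq {p q α : ℝ} (hα : α ≠ 0) :
    klBer (α * p) (α * q) =
      α * p * Real.log (p / q) + (1 - α * p) * Real.log ((1 - α * p) / (1 - α * q)) := by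
  rw [klBer, mul_div_mul_left _ _ hα]

theorem hasDerivAt_klBer_mul_mul {p q α : ℝ} (hα : 0 < α) (hp : 0 < 1 - α * p)
    (hq : 0 < 1 - α * q) :
    HasDerivAt (fun β => klBer (β * p) (β * q))
      (p * Real.log (p / q) - p * Real.log ((1 - α * p) / (1 - α * q))
        - p + q * (1 - α * p) / (1 - α * q)) α := by
  have hlin (c : ℝ) : HasDerivAt (fun β : ℝ => 1 - β * c) (-c) α := by
    simpa using ((hasDerivAt_id α).mul_const c).const_sub 1
  have hlog := ((hlin p).div (hlin q) hq.ne').log (div_pos hp hq).ne'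
  have hsum := (((hasDerivAt_id α).mul_const p).mul_const (Real.log (p / q))).add
    ((hlin p).mul hlog)
  refine (hsum.congr_of_eventuallyEq ?_).congr_deriv ?_
  · filter_upwards [eventually_ne_nhds hα.ne'] with β hβ
    exact klBer_mul_mul_eq hβ
  · simp only [Pi.div_apply]
    generalize Real.log ((1 - α * p) / (1 - α * q)) = L
    generalize Real.log (p / q) = M
    generalize 1 - α * p = u at hp ⊢
    generalize 1 - α * q = v at hq ⊢
    field_simp
    ring

theorem klBer_scaled_monotoneOn (p q : ℝ) (hp : p ∈ Set.Ioo (0 : ℝ) 1)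
    (hq : q ∈ Set.Ioo (0 : ℝ) 1) :
    MonotoneOn (fun α => klBer (α * p) (α * q)) (Set.Ioo (0 : ℝ) 1) := by
  obtain ⟨hp0, hp1⟩ := hp
  obtain ⟨hq0, hq1⟩ := hq
  have hpos {c α : ℝ} (hc : c < 1) (hα : α ∈ Set.Ioo (0 : ℝ) 1) : 0 < 1 - α * c := by
    nlinarith [hα.1, hα.2, mul_pos hα.1 (sub_pos.2 hc)]
  have hderiv {α : ℝ} (hα : α ∈ Set.Ioo (0 : ℝ) 1) :=
    hasDerivAt_klBer_mul_mul (p := p) (q := q) hα.1 (hpos hp1 hα) (hpos hq1 hα)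
  refine monotoneOn_of_hasDerivWithinAt_nonneg (convex_Ioo 0 1)
    (fun α hα => (hderiv hα).continuousAt.continuousWithinAt)
    (fun α hα => (hderiv (interior_subset hα)).hasDerivWithinAt) fun α hα => ?_
  have hα := interior_subset hα
  have hap := hpos hp1 hα
  have haq := hpos hq1 hα
  have hr : 0 < (p / q) / ((1 - α * p) / (1 - α * q)) := by positivity
  have key := mul_le_mul_of_nonneg_left (Real.one_sub_inv_le_log_of_pos hr) hp0.le
  rw [Real.log_div (by positivity) (by positivity)] at key
  have hinv : p * ((p / q) / ((1 - α * p) / (1 - α * q)))⁻¹ = q * (1 - α * p) / (1 - α * q) := by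
    field_simp
  linarith
end

section
/- Fix real numbers p, q ∈ (0, 1) with p ≠ q. The function f : α ↦ d(α·p, α·q) is strictly convex on the interval (0, 1). -/
/-- First derivative in `x` of the Bernoulli divergence between the scaled means `x * p`, `x * q`. -/
theorem hasDerivAt_klBer_scaled {p q x : ℝ} (hx : x ≠ 0)
    (hxp : 1 - x * p ≠ 0) (hxq : 1 - x * q ≠ 0) :
    HasDerivAt (fun α => klBer (α * p) (α * q))
      (p * Real.log (p / q) - p * (Real.log (1 - x * p) - Real.log (1 - x * q)) - p
        + q * (1 - x * p) / (1 - x * q)) x := by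
  have lin (c : ℝ) : HasDerivAt (fun α : ℝ => 1 - α * c) (-c) x := by
    simpa using ((hasDerivAt_id x).mul_const c).const_sub 1
  have main : HasDerivAt (fun α : ℝ => α * (p * Real.log (p / q))
      + (1 - α * p) * (Real.log (1 - α * p) - Real.log (1 - α * q)))
      (1 * (p * Real.log (p / q)) + (-p * (Real.log (1 - x * p) - Real.log (1 - x * q))
        + (1 - x * p) * (-p / (1 - x * p) - -q / (1 - x * q)))) x :=
    ((hasDerivAt_id x).mul_const _).add
      ((lin p).mul (((lin p).log hxp).sub ((lin q).log hxq)))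
  have hpx : 1 - p * x ≠ 0 := mul_comm x p ▸ hxp
  have hqx : 1 - q * x ≠ 0 := mul_comm x q ▸ hxq
  refine (main.congr_of_eventuallyEq ?_).congr_deriv (by field_simp; ring)
  filter_upwards [eventually_ne_nhds hx, (lin p).continuousAt.eventually_ne hxp,
    (lin q).continuousAt.eventually_ne hxq] with α hα hαp hαq
  rw [klBer, mul_div_mul_left _ _ hα, Real.log_div hαp hαq]
  ring

/-- Second derivative in `x` of the Bernoulli divergence between the scaled means `x * p`,
`x * q`. -/
theorem hasDerivAt_deriv_klBer_scaled {p q x : ℝ} (hx : x ≠ 0)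
    (hxp : 1 - x * p ≠ 0) (hxq : 1 - x * q ≠ 0) :
    HasDerivAt (deriv fun α => klBer (α * p) (α * q))
      ((p - q) ^ 2 / ((1 - x * p) * (1 - x * q) ^ 2)) x := by
  have lin (c : ℝ) : HasDerivAt (fun α : ℝ => 1 - α * c) (-c) x := by
    simpa using ((hasDerivAt_id x).mul_const c).const_sub 1
  have main := (((((lin p).log hxp).sub ((lin q).log hxq)).const_mul p).const_sub
    (p * Real.log (p / q))).sub_const p |>.add (((lin p).const_mul q).div (lin q) hxq)
  have hpx : 1 - p * x ≠ 0 := mul_comm x p ▸ hxp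
  have hqx : 1 - q * x ≠ 0 := mul_comm x q ▸ hxq
  refine (main.congr_of_eventuallyEq ?_).congr_deriv (by field_simp; ring)
  filter_upwards [eventually_ne_nhds hx, (lin p).continuousAt.eventually_ne hxp,
    (lin q).continuousAt.eventually_ne hxq] with α hα hαp hαq
  exact (hasDerivAt_klBer_scaled hα hαp hαq).deriv

theorem klBer_scaled_strictConvexOn (p q : ℝ) (hp : p ∈ Set.Ioo (0 : ℝ) 1)
    (hq : q ∈ Set.Ioo (0 : ℝ) 1) (hpq : p ≠ q) :
    StrictConvexOn ℝ (Set.Ioo (0 : ℝ) 1) (fun α => klBer (α * p) (α * q)) := by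
  have pos {c x : ℝ} (hc : c ∈ Set.Ioo (0 : ℝ) 1) (hx : x ∈ Set.Ioo (0 : ℝ) 1) :
      0 < 1 - x * c :=
    sub_pos.2 (mul_lt_one_of_nonneg_of_lt_one_left hx.1.le hx.2 hc.2.le)
  refine strictConvexOn_of_deriv2_pos' (convex_Ioo 0 1) (fun x hx => ?_) fun x hx => ?_
  · exact (hasDerivAt_klBer_scaled hx.1.ne' (pos hp hx).ne'
      (pos hq hx).ne').continuousAt.continuousWithinAt
  · have hxp := pos hp hx
    have hxq := pos hq hx
    have hne : p - q ≠ 0 := sub_ne_zero.2 hpq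
    rw [Function.iterate_succ_apply, Function.iterate_one,
      (hasDerivAt_deriv_klBer_scaled hx.1.ne' hxp.ne' hxq.ne').deriv]
    positivity
end

section
/- For all real numbers p, q ∈ (0, 1) with p ≠ q and every α ∈ (0, 1), one has d(α·p, α·q) < d(p, q). -/
theorem sub_lt_mul_log_div {x y : ℝ} (hx : 0 < x) (hy : 0 < y) (hxy : x ≠ y) :
    x - y < x * Real.log (x / y) := by
  have h := Real.log_lt_sub_one_of_pos (div_pos hy hx) (by
    rw [ne_eq, div_eq_one_iff_eq hx.ne']; exact hxy.symm)
  rw [← inv_div, Real.log_inv]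
  have h' := mul_lt_mul_of_pos_left h hx
  have e : x * (y / x - 1) = y - x := by field_simp
  linarith

theorem sub_le_mul_log_div {x y : ℝ} (hx : 0 < x) (hy : 0 < y) :
    x - y ≤ x * Real.log (x / y) := by
  rcases eq_or_ne x y with rfl | h
  · simp [hx.ne']
  · exact (sub_lt_mul_log_div hx hy h).le

theorem klBer_pos {p q : ℝ} (hp : p ∈ Set.Ioo (0 : ℝ) 1) (hq : q ∈ Set.Ioo (0 : ℝ) 1)
    (hpq : p ≠ q) : 0 < klBer p q := by
  have h₁ := sub_lt_mul_log_div hp.1 hq.1 hpq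
  have h₂ := sub_le_mul_log_div (sub_pos.2 hp.2) (sub_pos.2 hq.2)
  unfold klBer
  linarith

/-- The log-sum inequality for two pairs of positive reals. -/
theorem add_mul_log_div_add_le {a b c d : ℝ} (ha : 0 < a) (hb : 0 < b) (hc : 0 < c)
    (hd : 0 < d) :
    (a + b) * Real.log ((a + b) / (c + d)) ≤ a * Real.log (a / c) + b * Real.log (b / d) := by
  have hr : 0 < (a + b) / (c + d) := by positivity
  have h₁ := sub_le_mul_log_div ha (mul_pos hr hc)
  have h₂ := sub_le_mul_log_div hb (mul_pos hr hd)
  rw [mul_comm, ← div_div, Real.log_div (by positivity) hr.ne'] at h₁ h₂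
  have e : (a + b) / (c + d) * c + (a + b) / (c + d) * d = a + b := by field_simp
  linarith

theorem klBer_scaled_le {p q α : ℝ} (hp : p < 1) (hq : q < 1) (hα : α ∈ Set.Ioo (0 : ℝ) 1) :
    klBer (α * p) (α * q) ≤ α * klBer p q := by
  obtain ⟨hα₀, hα₁⟩ := hα
  have hα' : 0 < 1 - α := sub_pos.2 hα₁
  have h := add_mul_log_div_add_le hα' (mul_pos hα₀ (sub_pos.2 hp)) hα'
    (mul_pos hα₀ (sub_pos.2 hq))
  rw [div_self hα'.ne', Real.log_one, mul_div_mul_left _ _ hα₀.ne',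
    show 1 - α + α * (1 - p) = 1 - α * p by ring,
    show 1 - α + α * (1 - q) = 1 - α * q by ring] at h
  unfold klBer
  rw [mul_div_mul_left _ _ hα₀.ne']
  linarith

theorem klBer_scaled_lt (p q : ℝ) (hp : p ∈ Set.Ioo (0 : ℝ) 1)
    (hq : q ∈ Set.Ioo (0 : ℝ) 1) (hpq : p ≠ q)
    (α : ℝ) (hα : α ∈ Set.Ioo (0 : ℝ) 1) :
    klBer (α * p) (α * q) < klBer p q :=
  (klBer_scaled_le hp.2 hq.2 hα).trans_lt (mul_lt_of_lt_one_left (klBer_pos hp hq hpq) hα.2)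
end

section
/- For all real numbers p, q ∈ (0, 1) with p ≠ q and every α ∈ (0, 1), one has d(α·p, α·q) < α·d(p, q). -/
/-- The strict log-sum inequality for two pairs of positive reals. -/
theorem add_mul_log_div_add_lt {a b c d : ℝ} (ha : 0 < a) (hb : 0 < b) (hc : 0 < c)
    (hd : 0 < d) (h : a / c ≠ b / d) :
    (a + b) * Real.log ((a + b) / (c + d)) < a * Real.log (a / c) + b * Real.log (b / d) := by
  have hcd : 0 < c + d := add_pos hc hd
  have key := Real.strictConvexOn_mul_log.2 (Set.mem_Ici.2 (div_pos ha hc).le)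
    (Set.mem_Ici.2 (div_pos hb hd).le) h (div_pos hc hcd) (div_pos hd hcd)
    (by rw [← add_div, div_self hcd.ne'])
  simp only [smul_eq_mul] at key
  have hmean : c / (c + d) * (a / c) + d / (c + d) * (b / d) = (a + b) / (c + d) := by
    field_simp
  rw [hmean] at key
  have hmul := mul_lt_mul_of_pos_left key hcd
  have hleft : (c + d) * ((a + b) / (c + d) * Real.log ((a + b) / (c + d))) =
      (a + b) * Real.log ((a + b) / (c + d)) := by
    field_simp
  have hright : (c + d) * (c / (c + d) * (a / c * Real.log (a / c)) +
      d / (c + d) * (b / d * Real.log (b / d))) =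
      a * Real.log (a / c) + b * Real.log (b / d) := by
    field_simp
  rwa [hleft, hright] at hmul

theorem klBer_scaled_lt_mul (p q : ℝ) (hp : p ∈ Set.Ioo (0 : ℝ) 1)
    (hq : q ∈ Set.Ioo (0 : ℝ) 1) (hpq : p ≠ q)
    (α : ℝ) (hα : α ∈ Set.Ioo (0 : ℝ) 1) :
    klBer (α * p) (α * q) < α * klBer p q := by
  have hα0 : α ≠ 0 := hα.1.ne'
  have hα1 : 0 < 1 - α := sub_pos.2 hα.2
  have hp1 : 0 < 1 - p := sub_pos.2 hp.2
  have hq1 : 0 < 1 - q := sub_pos.2 hq.2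
  have hratio : (1 - α) / (1 - α) ≠ α * (1 - p) / (α * (1 - q)) := by
    rw [div_self hα1.ne', mul_div_mul_left _ _ hα0, ne_comm, Ne, div_eq_one_iff_eq hq1.ne']
    exact fun h ↦ hpq (sub_right_injective h)
  have key := add_mul_log_div_add_lt hα1 (mul_pos hα.1 hp1) hα1 (mul_pos hα.1 hq1) hratio
  have hsum (x : ℝ) : 1 - α + α * (1 - x) = 1 - α * x := by ring
  rw [hsum, hsum, div_self hα1.ne', Real.log_one, mul_zero, zero_add,
    mul_div_mul_left _ _ hα0] at key
  unfold klBer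
  rw [mul_div_mul_left _ _ hα0]
  linarith
end

section
/- For every θ ∈ (0, π/2), one has cos θ·log(cos θ / sin θ) + sin θ − cos θ ≥ 0. -/
open Real

theorem klBer_polar_deriv_at_zero_nonneg (θ : ℝ) (hθ : θ ∈ Set.Ioo 0 (π / 2)) :
    0 ≤ cos θ * log (cos θ / sin θ) + sin θ - cos θ := by
  have hs : 0 < sin θ := sin_pos_of_pos_of_lt_pi hθ.1 (by linarith [hθ.2, pi_pos])
  have hc : 0 < cos θ := cos_pos_of_mem_Ioo ⟨by linarith [hθ.1, pi_pos], hθ.2⟩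
  have hlog := mul_le_mul_of_nonneg_left (one_sub_inv_le_log_of_pos (div_pos hc hs)) hc.le
  have heq : cos θ * (1 - (cos θ / sin θ)⁻¹) = cos θ - sin θ := by
    field_simp
  linarith
end

section
/- Let K, L be positive integers and let ū : Fin K → ℝ, v̄ : Fin L → ℝ satisfy 0 < ū(i) < 1 and 0 < v̄(j) < 1 for all i, j, together with ū(i) < ū(0) for all i ≠ 0 and v̄(j) < v̄(0) for all j ≠ 0. Define c* : Fin K × Fin L → ℝ by c*(i, 0) = 1 / d(ū(i)·v̄(0), ū(0)·v̄(0)) for i ≠ 0, c*(0, j) = 1 / d(ū(0)·v̄(j), ū(0)·v̄(0)) for j ≠ 0, and c*(i, j) = 0 otherwise. Then c* is a feasible point of the relaxed lower-bound linear program: c* is nonnegative, for every j ≠ 0 one has Σ_{i ∈ Fin K} d(ū(i)·v̄(j), ū(i)·v̄(0))·c*(i, j) = 1, and for every i ≠ 0 one has Σ_{j ∈ Fin L} d(ū(i)·v̄(j), ū(0)·v̄(j))·c*(i, j) = 1. -/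
/-- The candidate optimal solution of the relaxed lower-bound linear program:
it is supported on the first row and the first column. -/
noncomputable def cstar {K L : ℕ} [NeZero K] [NeZero L]
    (u : Fin K → ℝ) (v : Fin L → ℝ) (i : Fin K) (j : Fin L) : ℝ :=
  if i ≠ 0 ∧ j = 0 then 1 / klBer (u i * v 0) (u 0 * v 0)
  else if i = 0 ∧ j ≠ 0 then 1 / klBer (u 0 * v j) (u 0 * v 0)
  else 0

theorem mul_mem_Ioo_zero_one {a b : ℝ} (ha : a ∈ Set.Ioo (0 : ℝ) 1)
    (hb : b ∈ Set.Ioo (0 : ℝ) 1) : a * b ∈ Set.Ioo (0 : ℝ) 1 :=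
  ⟨mul_pos ha.1 hb.1, mul_lt_one_of_nonneg_of_lt_one_left ha.1.le ha.2 hb.2.le⟩

theorem cstar_feasible (K L : ℕ) [NeZero K] [NeZero L]
    (u : Fin K → ℝ) (v : Fin L → ℝ)
    (hu : ∀ i, u i ∈ Set.Ioo (0 : ℝ) 1) (hv : ∀ j, v j ∈ Set.Ioo (0 : ℝ) 1)
    (huopt : ∀ i, i ≠ 0 → u i < u 0) (hvopt : ∀ j, j ≠ 0 → v j < v 0) :
    (∀ i j, 0 ≤ cstar u v i j)
    ∧ (∀ j, j ≠ 0 →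
        ∑ i : Fin K, klBer (u i * v j) (u i * v 0) * cstar u v i j = 1)
    ∧ (∀ i, i ≠ 0 →
        ∑ j : Fin L, klBer (u i * v j) (u 0 * v j) * cstar u v i j = 1) := by
  have hrow : ∀ i, i ≠ 0 → 0 < klBer (u i * v 0) (u 0 * v 0) := fun i hi =>
    klBer_pos (mul_mem_Ioo_zero_one (hu i) (hv 0)) (mul_mem_Ioo_zero_one (hu 0) (hv 0))
      (mul_lt_mul_of_pos_right (huopt i hi) (hv 0).1).ne
  have hcol : ∀ j, j ≠ 0 → 0 < klBer (u 0 * v j) (u 0 * v 0) := fun j hj =>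
    klBer_pos (mul_mem_Ioo_zero_one (hu 0) (hv j)) (mul_mem_Ioo_zero_one (hu 0) (hv 0))
      (mul_lt_mul_of_pos_left (hvopt j hj) (hu 0).1).ne
  refine ⟨fun i j => ?_, fun j hj => ?_, fun i hi => ?_⟩
  · unfold cstar
    split_ifs with h₁ h₂
    · exact (one_div_pos.mpr (hrow i h₁.1)).le
    · exact (one_div_pos.mpr (hcol j h₂.2)).le
    · exact le_rfl
  · rw [Finset.sum_eq_single 0 (fun i _ hi => by simp [cstar, hi, hj]) (by simp)]
    simp [cstar, hj, (hcol j hj).ne']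
  · rw [Finset.sum_eq_single 0 (fun j _ hj => by simp [cstar, hi, hj]) (by simp)]
    simp [cstar, hi, (hrow i hi).ne']
end

section
/- Let K, L be positive integers and let ū : Fin K → ℝ, v̄ : Fin L → ℝ satisfy 0 < ū(i) < 1 and 0 < v̄(j) < 1 for all i, j, together with ū(i) < ū(0) for all i ≠ 0 and v̄(j) < v̄(0) for all j ≠ 0. Let c : Fin K × Fin L → ℝ be any nonnegative function satisfying, for every j ≠ 0, Σ_{i ∈ Fin K} d(ū(i)·v̄(j), ū(i)·v̄(0))·c(i, j) ≥ 1, and, for every i ≠ 0, Σ_{j ∈ Fin L} d(ū(i)·v̄(j), ū(0)·v̄(j))·c(i, j) ≥ 1. Then Σ_{i,j} (ū(0)·v̄(0) − ū(i)·v̄(j))·c(i, j) ≥ Σ_{i ≠ 0} (ū(0)·v̄(0) − ū(i)·v̄(0)) / d(ū(i)·v̄(0), ū(0)·v̄(0)) + Σ_{j ≠ 0} (ū(0)·v̄(0) − ū(0)·v̄(j)) / d(ū(0)·v̄(j), ū(0)·v̄(0)). -/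
theorem div_mul_le_self {x : ℝ} (hx : 0 ≤ x) (d : ℝ) : x / d * d ≤ x := by
  rcases eq_or_ne d 0 with rfl | hd
  · simpa using hx
  · exact (div_mul_cancel₀ x hd).le

theorem klBer_nonneg {p q : ℝ} (hp : p ∈ Set.Ioo (0 : ℝ) 1) (hq : q ∈ Set.Ioo (0 : ℝ) 1) :
    0 ≤ klBer p q := by
  have sub_le {a b : ℝ} (ha : 0 < a) (hb : 0 < b) : a - b ≤ a * Real.log (a / b) := by
    have h := mul_le_mul_of_nonneg_left (Real.one_sub_inv_le_log_of_pos (div_pos ha hb)) ha.le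
    rwa [show a * (1 - (a / b)⁻¹) = a - b by field_simp] at h
  have h₁ := sub_le hp.1 hq.1
  have h₂ := sub_le (sub_pos.2 hp.2) (sub_pos.2 hq.2)
  unfold klBer
  linarith

/-- Scaling both means by `t ≤ 1` shrinks the divergence at least by the factor `t`. -/
theorem klBer_mul_le {p q t : ℝ} (hp : p ∈ Set.Ioo (0 : ℝ) 1) (hq : q ∈ Set.Ioo (0 : ℝ) 1)
    (ht : 0 < t) (ht1 : t ≤ 1) : klBer (t * p) (t * q) ≤ t * klBer p q := by
  obtain ⟨hp0, hp1⟩ := hp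
  obtain ⟨hq0, hq1⟩ := hq
  have hp' : 0 < 1 - p := sub_pos.2 hp1
  have hq' : 0 < 1 - q := sub_pos.2 hq1
  have hA : 0 < 1 - t * p := by nlinarith
  have hB : 0 < 1 - t * q := by nlinarith
  have h₁ := mul_le_mul_of_nonneg_left
    (Real.one_sub_inv_le_log_of_pos (div_pos (div_pos hp' hq') (div_pos hA hB)))
    (mul_pos ht hp').le
  have h₂ := mul_le_mul_of_nonneg_left
    (Real.log_le_sub_one_of_pos (div_pos hA hB)) (sub_nonneg.2 ht1)
  rw [Real.log_div (div_pos hp' hq').ne' (div_pos hA hB).ne'] at h₁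
  have key : t * (1 - p) * (1 - ((1 - p) / (1 - q) / ((1 - t * p) / (1 - t * q)))⁻¹)
      = (1 - t) * ((1 - t * p) / (1 - t * q) - 1) := by
    field_simp
    ring
  unfold klBer
  rw [mul_div_mul_left _ _ ht.ne']
  linarith

/-- The dual multiplier `(a * y - a * x) / klBer (a * x) (a * y)` is admissible for every mean
factor `b ≤ a`. -/
theorem div_klBer_mul_klBer_le {a b x y : ℝ} (ha : a ∈ Set.Ioo (0 : ℝ) 1) (hb : 0 < b)
    (hba : b ≤ a) (hx : x ∈ Set.Ioo (0 : ℝ) 1) (hy : y ∈ Set.Ioo (0 : ℝ) 1) (hxy : x ≤ y) :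
    (a * y - a * x) / klBer (a * x) (a * y) * klBer (b * x) (b * y) ≤ b * (y - x) := by
  have hmul {z : ℝ} (hz : z ∈ Set.Ioo (0 : ℝ) 1) : a * z ∈ Set.Ioo (0 : ℝ) 1 :=
    ⟨mul_pos ha.1 hz.1, mul_lt_one_of_nonneg_of_lt_one_left ha.1.le ha.2 hz.2.le⟩
  have hgap : 0 ≤ a * y - a * x := sub_nonneg.2 (mul_le_mul_of_nonneg_left hxy ha.1.le)
  have hscale := klBer_mul_le (hmul hx) (hmul hy) (div_pos hb ha.1) ((div_le_one ha.1).2 hba)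
  have ha' := ha.1.ne'
  rw [← mul_assoc, ← mul_assoc, div_mul_cancel₀ b ha'] at hscale
  calc (a * y - a * x) / klBer (a * x) (a * y) * klBer (b * x) (b * y)
      ≤ (a * y - a * x) / klBer (a * x) (a * y) * (b / a * klBer (a * x) (a * y)) :=
        mul_le_mul_of_nonneg_left hscale (div_nonneg hgap (klBer_nonneg (hmul hx) (hmul hy)))
    _ = b / a * ((a * y - a * x) / klBer (a * x) (a * y) * klBer (a * x) (a * y)) := by ring
    _ ≤ b / a * (a * y - a * x) :=
        mul_le_mul_of_nonneg_left (div_mul_le_self hgap _) (div_pos hb ha.1).le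
    _ = b * (y - x) := by field_simp

theorem lower_bound_LP_value (K L : ℕ) [NeZero K] [NeZero L]
    (u : Fin K → ℝ) (v : Fin L → ℝ)
    (hu : ∀ i, u i ∈ Set.Ioo (0 : ℝ) 1) (hv : ∀ j, v j ∈ Set.Ioo (0 : ℝ) 1)
    (huopt : ∀ i, i ≠ 0 → u i < u 0) (hvopt : ∀ j, j ≠ 0 → v j < v 0)
    (c : Fin K → Fin L → ℝ) (hc : ∀ i j, 0 ≤ c i j)
    (hcol : ∀ j, j ≠ 0 →
      1 ≤ ∑ i : Fin K, klBer (u i * v j) (u i * v 0) * c i j)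
    (hrow : ∀ i, i ≠ 0 →
      1 ≤ ∑ j : Fin L, klBer (u i * v j) (u 0 * v j) * c i j) :
    (∑ i ∈ Finset.univ.filter (· ≠ (0 : Fin K)),
        (u 0 * v 0 - u i * v 0) / klBer (u i * v 0) (u 0 * v 0))
    + (∑ j ∈ Finset.univ.filter (· ≠ (0 : Fin L)),
        (u 0 * v 0 - u 0 * v j) / klBer (u 0 * v j) (u 0 * v 0))
    ≤ ∑ i : Fin K, ∑ j : Fin L, (u 0 * v 0 - u i * v j) * c i j := by
  have hmul {x y : ℝ} (hx : x ∈ Set.Ioo (0 : ℝ) 1) (hy : y ∈ Set.Ioo (0 : ℝ) 1) :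
      x * y ∈ Set.Ioo (0 : ℝ) 1 :=
    ⟨mul_pos hx.1 hy.1, mul_lt_one_of_nonneg_of_lt_one_left hx.1.le hx.2 hy.2.le⟩
  have hu_le (i) : u i ≤ u 0 := by
    rcases eq_or_ne i 0 with rfl | hi
    · exact le_rfl
    · exact (huopt i hi).le
  have hv_le (j) : v j ≤ v 0 := by
    rcases eq_or_ne j 0 with rfl | hj
    · exact le_rfl
    · exact (hvopt j hj).le
  set μ : Fin K → ℝ := fun i ↦ (u 0 * v 0 - u i * v 0) / klBer (u i * v 0) (u 0 * v 0) with hμ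
  set ν : Fin L → ℝ := fun j ↦ (u 0 * v 0 - u 0 * v j) / klBer (u 0 * v j) (u 0 * v 0) with hν
  have hμ_nonneg (i) : 0 ≤ μ i :=
    div_nonneg (sub_nonneg.2 (mul_le_mul_of_nonneg_right (hu_le i) (hv 0).1.le))
      (klBer_nonneg (hmul (hu i) (hv 0)) (hmul (hu 0) (hv 0)))
  have hν_nonneg (j) : 0 ≤ ν j :=
    div_nonneg (sub_nonneg.2 (mul_le_mul_of_nonneg_left (hv_le j) (hu 0).1.le))
      (klBer_nonneg (hmul (hu 0) (hv j)) (hmul (hu 0) (hv 0)))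
  have hdual (i j) : μ i * klBer (u i * v j) (u 0 * v j) + ν j * klBer (u i * v j) (u i * v 0)
      ≤ u 0 * v 0 - u i * v j := by
    have h₁ := div_klBer_mul_klBer_le (hv 0) (hv j).1 (hv_le j) (hu i) (hu 0) (hu_le i)
    have h₂ := div_klBer_mul_klBer_le (hu 0) (hu i).1 (hu_le i) (hv j) (hv 0) (hv_le j)
    simp only [mul_comm (v _) (u _)] at h₁
    have h₃ := mul_nonneg (sub_nonneg.2 (hu_le i)) (sub_nonneg.2 (hv_le j))
    simp only [hμ, hν]
    linarith
  have hrows : ∑ i ∈ Finset.univ.filter (· ≠ (0 : Fin K)), μ i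
      ≤ ∑ i, ∑ j, μ i * klBer (u i * v j) (u 0 * v j) * c i j := by
    rw [Finset.sum_filter]
    refine Finset.sum_le_sum fun i _ ↦ ?_
    simp only [mul_assoc, ← Finset.mul_sum]
    split_ifs with hi
    · exact le_mul_of_one_le_right (hμ_nonneg i) (hrow i hi)
    · simp [hμ, not_not.1 hi]
  have hcols : ∑ j ∈ Finset.univ.filter (· ≠ (0 : Fin L)), ν j
      ≤ ∑ i, ∑ j, ν j * klBer (u i * v j) (u i * v 0) * c i j := by
    rw [Finset.sum_filter, Finset.sum_comm]
    refine Finset.sum_le_sum fun j _ ↦ ?_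
    simp only [mul_assoc, ← Finset.mul_sum]
    split_ifs with hj
    · exact le_mul_of_one_le_right (hν_nonneg j) (hcol j hj)
    · simp [hν, not_not.1 hj]
  refine (add_le_add hrows hcols).trans ?_
  simp only [← Finset.sum_add_distrib, ← add_mul]
  exact Finset.sum_le_sum fun i _ ↦ Finset.sum_le_sum fun j _ ↦
    mul_le_mul_of_nonneg_right (hdual i j) (hc i j)
end

section
/- Let T ≥ 1 and Δ ∈ (0, 1] be real numbers and let m be a natural number. Define n_ℓ = ⌈4·4^ℓ·T⌉ for natural numbers ℓ, and n_{−1} = 0. Then Σ_{ℓ=0}^{m} (Δ + 2^{m−ℓ+1}·Δ)·(n_ℓ − n_{ℓ−1}) ≤ 24·4^m·Δ·T + 1. -/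
/-- The cumulative number of exploration steps by the end of stage `ℓ` of the
elimination schedule: `n_ℓ = ⌈4 · 4^ℓ · T⌉`, where `T` plays the role of
`log n`. -/
noncomputable def nSched (T : ℝ) (ℓ : ℕ) : ℝ := ((⌈(4 : ℝ) * 4 ^ ℓ * T⌉ : ℤ) : ℝ)

lemma nSched_le (T : ℝ) (ℓ : ℕ) : nSched T ℓ ≤ 4 * 4 ^ ℓ * T + 1 :=
  (Int.ceil_lt_add_one _).le

lemma sum_nSched_increments (T : ℝ) (m : ℕ) :
    ∑ ℓ ∈ Finset.range (m + 1), (nSched T ℓ - if ℓ = 0 then 0 else nSched T (ℓ - 1))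
      = nSched T m := by
  induction m with
  | zero => simp
  | succ m ih => rw [Finset.sum_range_succ, ih]; simp

lemma sum_two_pow_mul_succ (d : ℕ → ℝ) (m : ℕ) :
    ∑ ℓ ∈ Finset.range (m + 2), 2 ^ (m + 1 - ℓ + 1) * d ℓ
      = 2 * ∑ ℓ ∈ Finset.range (m + 1), 2 ^ (m - ℓ + 1) * d ℓ + 2 * d (m + 1) := by
  rw [Finset.sum_range_succ, Finset.mul_sum]
  congr 1
  · refine Finset.sum_congr rfl fun ℓ hℓ => ?_
    have hle : ℓ ≤ m := Nat.lt_succ_iff.mp (Finset.mem_range.mp hℓ)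
    rw [Nat.sub_add_comm hle, pow_succ _ (m - ℓ + 1)]
    ring
  · simp

lemma sum_two_pow_mul_nSched_increments_le (T : ℝ) (m : ℕ) :
    ∑ ℓ ∈ Finset.range (m + 1),
        2 ^ (m - ℓ + 1) * (nSched T ℓ - if ℓ = 0 then 0 else nSched T (ℓ - 1))
      ≤ 2 * nSched T m + (4 * T * (4 ^ m - 2 ^ m) + 2 * 2 ^ m - 2) := by
  induction m with
  | zero => simp
  | succ m ih =>
    rw [sum_two_pow_mul_succ, if_neg m.succ_ne_zero, Nat.add_sub_cancel]
    have h := nSched_le T m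
    rw [pow_succ, pow_succ]
    linarith

theorem per_row_regret_sum_bound (T Δ : ℝ) (hT : 1 ≤ T)
    (hΔ0 : 0 < Δ) (hΔ1 : Δ ≤ 1) (m : ℕ) :
    ∑ ℓ ∈ Finset.range (m + 1),
        (Δ + 2 ^ (m - ℓ + 1) * Δ) *
          (nSched T ℓ - if ℓ = 0 then 0 else nSched T (ℓ - 1))
      ≤ 24 * 4 ^ m * Δ * T + 1 := by
  have hsum := sum_two_pow_mul_nSched_increments_le T m
  have hn := nSched_le T m
  have h2 : (1 : ℝ) ≤ 2 ^ m := one_le_pow₀ one_le_two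
  have h2T : (2 : ℝ) ^ m ≤ 2 ^ m * T := le_mul_of_one_le_right (by positivity) hT
  have h4T : (0 : ℝ) ≤ 4 ^ m * T := by positivity
  calc
    _ = Δ * (nSched T m + ∑ ℓ ∈ Finset.range (m + 1),
          2 ^ (m - ℓ + 1) * (nSched T ℓ - if ℓ = 0 then 0 else nSched T (ℓ - 1))) := by
      nth_rw 1 [← sum_nSched_increments T m]
      rw [← Finset.sum_add_distrib, Finset.mul_sum]
      exact Finset.sum_congr rfl fun ℓ _ => by ring
    _ ≤ Δ * (24 * 4 ^ m * T + 1) := mul_le_mul_of_nonneg_left (by linarith) hΔ0.le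
    _ ≤ 24 * 4 ^ m * Δ * T + 1 := by linarith
end
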